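/- Let f, g : ℂ → ℂ and let Φ : ℂ → ℂ³ be complex differentiable at z₀ with derivative Φ'(z₀) = φ(z₀) = (f(z₀)(1-g(z₀)²), i·f(z₀)(1+g(z₀)²), 2f(z₀)g(z₀)). Define x(u,v) = Re Φ(u + iv). Then at z₀ = u₀ + iv₀ the partial derivatives satisfy x_u · x_v = 0 (orthogonality), where · is the real dot product on ℝ³. -/

import Mathlib

/-- The Weierstrass vector `φ(z) = (f(z)(1-g(z)²), i·f(z)(1+g(z)²), 2f(z)g(z))`. -/
def weierstrassVec (f g : ℂ) : ℂ × ℂ × ℂ :=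
  (f * (1 - g ^ 2), Complex.I * f * (1 + g ^ 2), 2 * f * g)

/-- Componentwise real part of a vector in ℂ³. -/
def reVec (w : ℂ × ℂ × ℂ) : ℝ × ℝ × ℝ := (w.1.re, w.2.1.re, w.2.2.re)

/-- The real dot product on ℝ³. -/
def dot3 (a b : ℝ × ℝ × ℝ) : ℝ := a.1 * b.1 + a.2.1 * b.2.1 + a.2.2 * b.2.2

/-- Chain rule for the componentwise real part of a holomorphic map along a real curve. -/
theorem HasDerivAt.reVec_comp {Φ : ℂ → ℂ × ℂ × ℂ} {w : ℂ × ℂ × ℂ} {c : ℝ → ℂ} {c' : ℂ} {t : ℝ}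
    (hc : HasDerivAt c c' t) (hΦ : HasDerivAt Φ w (c t)) :
    HasDerivAt (fun s => reVec (Φ (c s))) (reVec (c' • w)) t := by
  have h := (hΦ.scomp t hc).hasFDerivAt
  have h₁ := (Complex.reCLM.hasFDerivAt.comp t h.fst).hasDerivAt
  have h₂ := (Complex.reCLM.hasFDerivAt.comp t h.snd.fst).hasDerivAt
  have h₃ := (Complex.reCLM.hasFDerivAt.comp t h.snd.snd).hasDerivAt
  simpa [reVec, Function.comp_def] using h₁.prodMk (h₂.prodMk h₃)

/-- For an isotropic vector `w`, the real parts of `w` and `i w` are orthogonal. -/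
theorem dot3_reVec_I_smul_eq_zero {w : ℂ × ℂ × ℂ}
    (hw : w.1 ^ 2 + w.2.1 ^ 2 + w.2.2 ^ 2 = 0) :
    dot3 (reVec w) (reVec (Complex.I • w)) = 0 := by
  have h := congrArg Complex.im hw
  simp only [pow_two, Complex.add_im, Complex.mul_im, Complex.zero_im] at h
  simp only [dot3, reVec, Prod.smul_fst, Prod.smul_snd, smul_eq_mul, Complex.I_mul_re]
  linarith

/-- The Weierstrass vector is isotropic. -/
theorem weierstrassVec_isotropic (f g : ℂ) :
    (weierstrassVec f g).1 ^ 2 + (weierstrassVec f g).2.1 ^ 2 +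
      (weierstrassVec f g).2.2 ^ 2 = 0 := by
  simp only [weierstrassVec, mul_pow, Complex.I_sq]
  ring

/-- If `Φ : ℂ → ℂ³` is complex differentiable at `z₀ = u₀ + i v₀` with derivative
the Weierstrass vector `φ(z₀)` determined by `f, g : ℂ → ℂ`, and
`x(u,v) = Re Φ(u + iv)`, then the partial derivatives of `x` at `(u₀, v₀)` satisfy
`x_u · x_v = 0`. -/
theorem xu_dot_xv_eq_zero (f g : ℂ → ℂ) (Φ : ℂ → ℂ × ℂ × ℂ) (u₀ v₀ : ℝ)
    (hΦ : HasDerivAt Φ (weierstrassVec (f (u₀ + v₀ * Complex.I)) (g (u₀ + v₀ * Complex.I)))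
      (u₀ + v₀ * Complex.I))
    (x : ℝ × ℝ → ℝ × ℝ × ℝ)
    (hx : ∀ u v : ℝ, x (u, v) = reVec (Φ (u + v * Complex.I))) :
    dot3 (deriv (fun u : ℝ => x (u, v₀)) u₀) (deriv (fun v : ℝ => x (u₀, v)) v₀) = 0 := by
  have hu : HasDerivAt (fun u : ℝ => (u : ℂ) + v₀ * Complex.I) 1 u₀ :=
    Complex.ofRealCLM.hasDerivAt.add_const _
  have hv : HasDerivAt (fun v : ℝ => (u₀ : ℂ) + v * Complex.I) Complex.I v₀ := by
    simpa using (Complex.ofRealCLM.hasDerivAt.mul_const Complex.I).const_add (u₀ : ℂ)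
  simp only [hx]
  rw [(hu.reVec_comp hΦ).deriv, (hv.reVec_comp hΦ).deriv, one_smul]
  exact dot3_reVec_I_smul_eq_zero (weierstrassVec_isotropic _ _)
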